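/- (Combinatorial form of the SUBSET-SUM theorem.) There is a universal constant C > 0 such that the following holds for all integers n ≥ 2. Let H := {0,1}^n ∖ {0^n} ⊆ ℝ^n. Then for every x = (a₁,…,a_n) ∈ ℝ^n there exists a subset S ⊆ H with |S| ≤ C·n²·log₂ n such that H ⊆ infer(S,x). In particular, the answers to the label queries sign(Σ_{i∈A′} a_i) for subsets A′ indexing elements of S, together with the comparison queries sign(Σ_{i∈A′} a_i − Σ_{i∈A″} a_i) for pairs of subsets A′, A″ indexing elements of S, determine whether some nonempty subset of {a₁,…,a_n} sums to 0. -/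

import Mathlib

open Finset

namespace LDT

/-- The standard inner product on `ℝ^n`. -/
def ip {n : ℕ} (x h : Fin n → ℝ) : ℝ := ∑ i, x i * h i

/-- `S` infers `h` at `x`: the sign of `⟨x,h⟩` is determined by the signs of `⟨x,v⟩` for
`v ∈ S ∪ (S - S)`, i.e. every `x'` with the same sign pattern as `x` on `S ∪ (S-S)` gives the
same sign on `h`. -/
def Infers {n : ℕ} (S : Finset (Fin n → ℝ)) (x h : Fin n → ℝ) : Prop :=
  ∀ x' : Fin n → ℝ,
    (∀ v ∈ S, SignType.sign (ip x' v) = SignType.sign (ip x v)) →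
    (∀ v ∈ S, ∀ w ∈ S, SignType.sign (ip x' (v - w)) = SignType.sign (ip x (v - w))) →
    SignType.sign (ip x' h) = SignType.sign (ip x h)

/-- `H` has inference dimension at most `d`: every subset `S ⊆ H` of size at least `d` contains,
for every `x`, an element `h` inferred by `S \ {h}` at `x`. -/
def InfProp {n : ℕ} (H : Finset (Fin n → ℝ)) (d : ℕ) : Prop :=
  ∀ S ⊆ H, d ≤ S.card → ∀ x : Fin n → ℝ, ∃ h ∈ S, Infers (S.erase h) x h

open scoped Classical

/-- The set `H = {0,1}^n ∖ {0^n}` of indicators of nonempty subsets of `[n]`, as a subset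
of `ℝ^n`. -/
noncomputable def subsetSumH (n : ℕ) : Finset (Fin n → ℝ) :=
  (Fintype.piFinset (fun _ : Fin n => ({0, 1} : Finset ℝ))).filter (fun h => h ≠ 0)

theorem ip_add {n : ℕ} (x u v : Fin n → ℝ) : ip x (u + v) = ip x u + ip x v := by
  simp [ip, mul_add, Finset.sum_add_distrib]

theorem ip_sub {n : ℕ} (x u v : Fin n → ℝ) : ip x (u - v) = ip x u - ip x v := by
  simp [ip, mul_sub, Finset.sum_sub_distrib]

theorem ip_smul {n : ℕ} (x v : Fin n → ℝ) (c : ℝ) : ip x (c • v) = c * ip x v := by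
  simp only [ip, Pi.smul_apply, smul_eq_mul, Finset.mul_sum]
  exact Finset.sum_congr rfl fun i _ => by ring

theorem ip_sum {n : ℕ} {ι : Type*} (x : Fin n → ℝ) (s : Finset ι) (v : ι → Fin n → ℝ) :
    ip x (∑ i ∈ s, v i) = ∑ i ∈ s, ip x (v i) := by
  simp only [ip, Finset.sum_apply, Finset.mul_sum]
  exact Finset.sum_comm

theorem ip_neg_left {n : ℕ} (x v : Fin n → ℝ) : ip (-x) v = -ip x v := by
  simp [ip]

theorem Infers.mono {n : ℕ} {S T : Finset (Fin n → ℝ)} {x h : Fin n → ℝ} (hST : S ⊆ T)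
    (hS : Infers S x h) : Infers T x h := fun x' h1 h2 =>
  hS x' (fun v hv => h1 v (hST hv)) fun v hv w hw => h2 v (hST hv) w (hST hw)

theorem infers_of_mem {n : ℕ} {S : Finset (Fin n → ℝ)} {x h : Fin n → ℝ} (hh : h ∈ S) :
    Infers S x h := fun _ h1 _ => h1 h hh

theorem infers_of_neg {n : ℕ} {S : Finset (Fin n → ℝ)} {x h : Fin n → ℝ}
    (hS : Infers S (-x) h) : Infers S x h := by
  intro x' h1 h2
  have := hS (-x')
    (fun v hv => by simp only [ip_neg_left, Left.sign_neg, h1 v hv])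
    (fun v hv w hw => by simp only [ip_neg_left, Left.sign_neg, h2 v hv w hw])
  simpa only [ip_neg_left, Left.sign_neg, neg_inj] using this

/-- A sequence of vectors with entries in `{0,1}` which is long enough has a term that equals the
initial term plus a nonnegative combination of the preceding increments. -/
theorem exists_eq_add_nonneg_combination {n M : ℕ} (hM : (2 * M + 1) ^ n < 2 ^ M)
    (h : ℕ → Fin n → ℝ) (h01 : ∀ i j, h i j = 0 ∨ h i j = 1) :
    ∃ p < M, ∃ c : ℕ → ℝ, (∀ i, 0 ≤ c i) ∧
      h (p + 1) = h 0 + ∑ i ∈ range p, c i • (h (i + 1) - h i) := by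
  let D : ℕ → Fin n → ℝ := fun i => h (i + 1) - h i
  let box : Finset (Fin n → ℝ) :=
    Fintype.piFinset fun _ => (Finset.Icc (-(M : ℤ)) M).image fun z : ℤ => (z : ℝ)
  have hbox : box.card < (range M).powerset.card := by
    rw [Finset.card_powerset, Finset.card_range, Fintype.card_piFinset_const]
    refine lt_of_le_of_lt (Nat.pow_le_pow_left (Finset.card_image_le.trans ?_) n) hM
    simp only [Int.card_Icc]
    omega
  have hD : ∀ i j, ∃ z : ℤ, D i j = z ∧ |z| ≤ 1 := by
    intro i j
    simp only [D, Pi.sub_apply]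
    rcases h01 (i + 1) j with h1 | h1 <;> rcases h01 i j with h2 | h2 <;> rw [h1, h2]
    · exact ⟨0, by simp, by simp⟩
    · exact ⟨-1, by simp, by simp⟩
    · exact ⟨1, by simp, by simp⟩
    · exact ⟨0, by simp, by simp⟩
  choose z hz hz1 using hD
  have hmaps : ∀ A ∈ (range M).powerset, (∑ i ∈ A, D i) ∈ box := by
    intro A hA
    rw [Fintype.mem_piFinset]
    intro j
    refine Finset.mem_image.2 ⟨∑ i ∈ A, z i j, ?_, ?_⟩
    · rw [Finset.mem_Icc, ← abs_le]
      refine (Finset.abs_sum_le_sum_abs _ _).trans ?_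
      refine (Finset.sum_le_card_nsmul _ _ 1 fun i _ => hz1 i j).trans ?_
      have := Finset.card_le_card (Finset.mem_powerset.1 hA)
      rw [Finset.card_range] at this
      simpa using this
    · simp [hz]
  obtain ⟨A, hA, B, hB, hAB, hsum⟩ := Finset.exists_ne_map_eq_of_card_lt_of_maps_to hbox hmaps
  rw [Finset.mem_powerset] at hA hB
  let α : ℕ → ℝ := fun i => (if i ∈ A then 1 else 0) - (if i ∈ B then 1 else 0)
  have hα : ∑ i ∈ range M, α i • D i = 0 := by
    have key : ∀ A ⊆ range M,
        ∑ i ∈ range M, (if i ∈ A then (1 : ℝ) else 0) • D i = ∑ i ∈ A, D i := by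
      intro A hA
      simp only [ite_smul, one_smul, zero_smul]
      rw [Finset.sum_ite_mem, Finset.inter_eq_right.2 hA]
    simp only [α, sub_smul, Finset.sum_sub_distrib]
    rw [key A hA, key B hB, hsum, sub_self]
  have hne : (symmDiff A B).Nonempty := by
    rw [Finset.nonempty_iff_ne_empty]
    intro h0
    exact hAB (symmDiff_eq_bot.1 h0)
  obtain ⟨p, hp, hpmax⟩ : ∃ p ∈ symmDiff A B, ∀ q ∈ symmDiff A B, q ≤ p :=
    ⟨_, Finset.max'_mem _ hne, fun q hq => Finset.le_max' _ q hq⟩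
  have hpM : p < M := by
    rcases Finset.mem_symmDiff.1 hp with h1 | h1
    · exact Finset.mem_range.1 (hA h1.1)
    · exact Finset.mem_range.1 (hB h1.1)
  have hαp : ∑ i ∈ range p, α i • D i + α p • D p = 0 := by
    rw [← Finset.sum_range_succ, ← hα]
    refine Finset.sum_subset (Finset.range_subset_range.2 hpM) fun q _ hq => ?_
    have hq' : q ∉ symmDiff A B := fun hm => hq (Finset.mem_range.2 (Nat.lt_succ_of_le (hpmax q hm)))
    have hiff : q ∈ A ↔ q ∈ B := by
      rw [Finset.mem_symmDiff] at hq'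
      tauto
    simp [α, hiff]
  have habs : ∀ i, |α i| ≤ 1 := by
    intro i
    simp only [α]
    split_ifs <;> simp
  obtain ⟨β, hβ, hβp⟩ : ∃ β : ℕ → ℝ, (∀ i, |β i| ≤ 1) ∧ D p = ∑ i ∈ range p, β i • D i := by
    rcases Finset.mem_symmDiff.1 hp with h1 | h1
    · refine ⟨fun i => -α i, fun i => by simpa using habs i, ?_⟩
      have : α p = 1 := by simp [α, h1.1, h1.2]
      rw [this, one_smul] at hαp
      simp only [neg_smul, Finset.sum_neg_distrib]
      exact eq_neg_of_add_eq_zero_right hαp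
    · refine ⟨α, habs, ?_⟩
      have : α p = -1 := by simp [α, h1.1, h1.2]
      rw [this, neg_one_smul, ← sub_eq_add_neg] at hαp
      exact (sub_eq_zero.1 hαp).symm
  refine ⟨p, hpM, fun i => 1 + β i, fun i => by linarith [(abs_le.1 (hβ i)).1], ?_⟩
  simp only [add_smul, one_smul, Finset.sum_add_distrib]
  rw [Finset.sum_range_sub h p, ← hβp]
  simp only [D]
  abel

/-- A large enough set of vectors with entries in `{0,1}`, all having the same nonnegative sign
at `x`, contains an element inferred by the others. -/
theorem exists_infers_erase_of_sign_eq {n M : ℕ} (hM : (2 * M + 1) ^ n < 2 ^ M)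
    {T : Finset (Fin n → ℝ)} (h01 : ∀ h ∈ T, ∀ j, h j = 0 ∨ h j = 1) (hT : M + 1 ≤ T.card)
    {x : Fin n → ℝ} {s : SignType} (hs0 : 0 ≤ s) (hs : ∀ h ∈ T, SignType.sign (ip x h) = s) :
    ∃ h ∈ T, Infers (T.erase h) x h := by
  obtain ⟨e⟩ : Nonempty (Fin (M + 1) ↪ T) :=
    Function.Embedding.nonempty_of_card_le (by simpa using hT)
  let f : Fin (M + 1) → ℝ := fun i => ip x (e i)
  have hmono : Monotone (f ∘ Tuple.sort f) := Tuple.monotone_sort f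
  let idx : ℕ → Fin (M + 1) := fun i => ⟨min i M, by omega⟩
  let h : ℕ → Fin n → ℝ := fun i => e (Tuple.sort f (idx i))
  have hmem : ∀ i, h i ∈ T := fun i => (e (Tuple.sort f (idx i))).2
  have hinj : ∀ i j, i ≤ M → j ≤ M → h i = h j → i = j := by
    intro i j hi hj hij
    have := (Tuple.sort f).injective (e.injective (Subtype.ext hij))
    simpa [idx, hi, hj] using this
  have hle : ∀ i, ip x (h i) ≤ ip x (h (i + 1)) := fun i =>
    hmono (show idx i ≤ idx (i + 1) by simp only [idx, Fin.mk_le_mk]; omega)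
  obtain ⟨p, hp, c, hc, heq⟩ := exists_eq_add_nonneg_combination hM h fun i => h01 _ (hmem i)
  refine ⟨h (p + 1), hmem _, fun x' h1 h2 => ?_⟩
  have herase : ∀ i ≤ p, h i ∈ T.erase (h (p + 1)) := fun i hi =>
    Finset.mem_erase.2 ⟨fun hij => by have := hinj _ _ (by omega) (by omega) hij; omega, hmem i⟩
  have hip : ip x' (h (p + 1)) =
      ip x' (h 0) + ∑ i ∈ range p, c i * ip x' (h (i + 1) - h i) := by
    rw [heq, ip_add, ip_sum]
    simp only [ip_smul]
  have hdiff : ∀ i ∈ range p,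
      SignType.sign (ip x' (h (i + 1) - h i)) = SignType.sign (ip x (h (i + 1) - h i)) := by
    intro i hi
    rw [Finset.mem_range] at hi
    exact h2 _ (herase _ (by omega)) _ (herase _ (by omega))
  have h0 : SignType.sign (ip x' (h 0)) = s := by
    rw [h1 _ (herase 0 (by omega)), hs _ (hmem 0)]
  rw [hs _ (hmem _), hip]
  rcases hs0.eq_or_lt with hs0 | hs0
  · subst hs0
    have hz : ∀ i, ip x (h i) = 0 := fun i => sign_eq_zero_iff.1 (hs _ (hmem i))
    rw [sign_eq_zero_iff] at h0 ⊢
    rw [h0, zero_add]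
    refine Finset.sum_eq_zero fun i hi => ?_
    have := hdiff i hi
    rw [ip_sub x, hz, hz, sub_self, sign_zero, sign_eq_zero_iff] at this
    rw [this, mul_zero]
  · have hs1 : s = 1 := by
      revert hs0
      cases s <;> decide
    subst hs1
    rw [sign_eq_one_iff] at h0 ⊢
    refine add_pos_of_pos_of_nonneg h0 (Finset.sum_nonneg fun i hi => mul_nonneg (hc i) ?_)
    rw [← sign_nonneg_iff, hdiff i hi, sign_nonneg_iff, ip_sub]
    exact sub_nonneg.2 (hle i)

theorem infProp_of_zero_one {n M : ℕ} (hM : (2 * M + 1) ^ n < 2 ^ M)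
    {H : Finset (Fin n → ℝ)} (h01 : ∀ h ∈ H, ∀ j, h j = 0 ∨ h j = 1) :
    InfProp H (3 * (M + 1)) := by
  intro S hSH hS x
  obtain ⟨s, -, hs⟩ := Finset.exists_le_card_fiber_of_mul_le_card_of_maps_to
    (s := S) (t := (Finset.univ : Finset SignType)) (f := fun h => SignType.sign (ip x h))
    (n := M + 1) (fun _ _ => Finset.mem_univ _) Finset.univ_nonempty
    (by rw [show (Finset.univ : Finset SignType).card = 3 from rfl]; exact hS)
  set T := S.filter fun h => SignType.sign (ip x h) = s with hTdef
  have hTS : T ⊆ S := Finset.filter_subset _ _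
  have hT01 : ∀ h ∈ T, ∀ j, h j = 0 ∨ h j = 1 := fun h hh => h01 h (hSH (hTS hh))
  have hTs : ∀ h ∈ T, SignType.sign (ip x h) = s := fun h hh => (Finset.mem_filter.1 hh).2
  obtain ⟨h, hh, hinf⟩ : ∃ h ∈ T, Infers (T.erase h) x h := by
    rcases le_total 0 s with h0 | h0
    · exact exists_infers_erase_of_sign_eq hM hT01 hs h0 hTs
    · obtain ⟨h, hh, hinf⟩ := exists_infers_erase_of_sign_eq hM hT01 hs (x := -x) (s := -s)
        (by revert h0; cases s <;> decide)
        (fun h hh => by rw [ip_neg_left, Left.sign_neg, hTs h hh])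
      exact ⟨h, hh, infers_of_neg hinf⟩
  exact ⟨h, hTS hh, hinf.mono (Finset.erase_subset_erase _ hTS)⟩

/-- In any tuple of elements of `H`, fewer than `d` entries fail to be inferred by the remaining
entries, where `d` bounds the inference dimension. -/
theorem card_not_infers_lt {n d k : ℕ} {H T : Finset (Fin n → ℝ)} (hH : InfProp H d)
    (hTH : T ⊆ H) (x : Fin n → ℝ) (f : Fin (k + 1) → T) :
    (Finset.univ.filter fun i : Fin (k + 1) =>
      ¬ Infers (Finset.univ.image fun j : Fin k => (f (i.succAbove j) : Fin n → ℝ)) x (f i)).card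
      < d := by
  set I := Finset.univ.filter fun i : Fin (k + 1) =>
      ¬ Infers (Finset.univ.image fun j : Fin k => (f (i.succAbove j) : Fin n → ℝ)) x (f i)
    with hI
  by_contra! hcon
  have hothers : ∀ i i', i' ≠ i → (f i' : Fin n → ℝ) ∈
      Finset.univ.image fun j : Fin k => (f (i.succAbove j) : Fin n → ℝ) := by
    intro i i' hne
    obtain ⟨j, rfl⟩ := Fin.exists_succAbove_eq hne
    exact Finset.mem_image_of_mem _ (Finset.mem_univ j)
  have hinj : Set.InjOn (fun i => (f i : Fin n → ℝ)) I := by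
    intro i hi i' _ hii
    by_contra hne
    refine (Finset.mem_filter.1 hi).2 (infers_of_mem ?_)
    have hii' : (f i : Fin n → ℝ) = f i' := hii
    rw [hii']
    exact hothers i i' (Ne.symm hne)
  obtain ⟨h, hh, hinf⟩ := hH (I.image fun i => (f i : Fin n → ℝ))
    (fun v hv => by
      obtain ⟨i, -, rfl⟩ := Finset.mem_image.1 hv
      exact hTH (f i).2)
    (by rwa [Finset.card_image_of_injOn hinj]) x
  obtain ⟨i, hi, rfl⟩ := Finset.mem_image.1 hh
  refine (Finset.mem_filter.1 hi).2 (hinf.mono fun v hv => ?_)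
  obtain ⟨hne, hv⟩ := Finset.mem_erase.1 hv
  obtain ⟨i', -, rfl⟩ := Finset.mem_image.1 hv
  exact hothers i i' fun hii => hne (by rw [hii])

/-- A set with inference dimension at most `d` has a subset of size less than `2 * d` that infers
more than half of it. -/
theorem exists_infers_more_than_half {n d : ℕ} {H T : Finset (Fin n → ℝ)} (hH : InfProp H d)
    (hTH : T ⊆ H) (hT : T.Nonempty) (hd : 0 < d) (x : Fin n → ℝ) :
    ∃ S ⊆ T, S.card ≤ 2 * d ∧ 2 * (T.filter fun h => ¬ Infers S x h).card < T.card := by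
  obtain ⟨k, hk⟩ : ∃ k, 2 * d = k + 1 := ⟨2 * d - 1, by omega⟩
  let im : (Fin k → T) → Finset (Fin n → ℝ) := fun g => Finset.univ.image fun j => (g j : Fin n → ℝ)
  have him : ∀ g, im g ⊆ T := fun g v hv => by
    obtain ⟨j, -, rfl⟩ := Finset.mem_image.1 hv
    exact (g j).2
  have himc : ∀ g, (im g).card ≤ 2 * d := fun g =>
    Finset.card_image_le.trans (by simp; omega)
  by_contra! hcon
  have hTc : 0 < T.card := hT.card_pos
  let b : (Fin k → T) → T → ℕ := fun g h => if Infers (im g) x h then 0 else 1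
  have hlow : ∀ g, T.card ≤ 2 * ∑ h : T, b g h := by
    intro g
    refine (hcon (im g) (him g) (himc g)).trans (le_of_eq ?_)
    rw [Finset.card_filter, ← Finset.sum_coe_sort T]
    congr 1
    exact Finset.sum_congr rfl fun h _ => by by_cases hI : Infers (im g) x h <;> simp [b, hI]
  have hsum : ∀ i : Fin (k + 1), T.card ^ (k + 1) ≤
      2 * ∑ f : Fin (k + 1) → T, b (fun j => f (i.succAbove j)) (f i) := by
    intro i
    rw [← (Fin.insertNthEquiv (fun _ => T) i).sum_comp, Fintype.sum_prod_type_right]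
    simp only [Fin.insertNthEquiv_apply, Fin.insertNth_apply_succAbove, Fin.insertNth_apply_same]
    rw [Finset.mul_sum]
    calc T.card ^ (k + 1) = ∑ _g : Fin k → T, T.card := by simp [pow_succ]
      _ ≤ _ := Finset.sum_le_sum fun g _ => hlow g
  have hup : ∀ f : Fin (k + 1) → T,
      ∑ i : Fin (k + 1), b (fun j => f (i.succAbove j)) (f i) < d := by
    intro f
    refine lt_of_eq_of_lt ?_ (card_not_infers_lt hH hTH x f)
    rw [Finset.card_filter]
    exact Finset.sum_congr rfl fun i _ => by
      by_cases hI : Infers (im fun j => f (i.succAbove j)) x (f i) <;> simp [b, im, hI]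
  have htot : (k + 1) * T.card ^ (k + 1) ≤ 2 * ((d - 1) * T.card ^ (k + 1)) := by
    calc (k + 1) * T.card ^ (k + 1) = ∑ _i : Fin (k + 1), T.card ^ (k + 1) := by simp
      _ ≤ ∑ i : Fin (k + 1), 2 * ∑ f : Fin (k + 1) → T, b (fun j => f (i.succAbove j)) (f i) :=
        Finset.sum_le_sum fun i _ => hsum i
      _ = 2 * ∑ f : Fin (k + 1) → T, ∑ i : Fin (k + 1), b (fun j => f (i.succAbove j)) (f i) := by
        rw [← Finset.mul_sum, Finset.sum_comm]
      _ ≤ 2 * ∑ _f : Fin (k + 1) → T, (d - 1) := by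
        refine Nat.mul_le_mul_left 2 (Finset.sum_le_sum fun f _ => ?_)
        have := hup f
        omega
      _ = 2 * ((d - 1) * T.card ^ (k + 1)) := by simp [mul_comm]
  rw [← mul_assoc] at htot
  have := Nat.le_of_mul_le_mul_right htot (pow_pos hTc _)
  omega

theorem exists_infers_all {n d : ℕ} {H : Finset (Fin n → ℝ)} (hH : InfProp H d) (hd : 0 < d)
    (x : Fin n → ℝ) (r : ℕ) :
    ∀ T ⊆ H, T.card < 2 ^ r → ∃ S ⊆ T, S.card ≤ r * (2 * d) ∧ ∀ h ∈ T, Infers S x h := by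
  induction r with
  | zero =>
    intro T _ hT
    obtain rfl : T = ∅ := Finset.card_eq_zero.1 (by simpa using hT)
    exact ⟨∅, by simp⟩
  | succ r ih =>
    intro T hTH hT
    rcases T.eq_empty_or_nonempty with rfl | hne
    · exact ⟨∅, by simp⟩
    obtain ⟨S₁, hS₁T, hS₁c, hS₁⟩ := exists_infers_more_than_half hH hTH hne hd x
    obtain ⟨S₂, hS₂T, hS₂c, hS₂⟩ := ih (T.filter fun h => ¬ Infers S₁ x h)
      ((Finset.filter_subset _ _).trans hTH) (by rw [pow_succ] at hT; omega)
    refine ⟨S₁ ∪ S₂, Finset.union_subset hS₁T (hS₂T.trans (Finset.filter_subset _ _)), ?_, ?_⟩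
    · have := Finset.card_union_le S₁ S₂
      rw [Nat.succ_mul]
      omega
    · intro h hh
      by_cases hI : Infers S₁ x h
      · exact hI.mono Finset.subset_union_left
      · exact (hS₂ h (Finset.mem_filter.2 ⟨hh, hI⟩)).mono Finset.subset_union_right

theorem card_subsetSumH_lt (n : ℕ) : (subsetSumH n).card < 2 ^ n := by
  have hcard : (Fintype.piFinset fun _ : Fin n => ({0, 1} : Finset ℝ)).card = 2 ^ n := by
    rw [Fintype.card_piFinset_const, Finset.card_pair zero_ne_one]
  rw [← hcard]
  refine Finset.card_lt_card (Finset.filter_ssubset.2 ⟨0, ?_, by simp⟩)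
  simp [Fintype.mem_piFinset]

theorem pow_lt_two_pow_of_log {n : ℕ} (hn : 2 ≤ n) :
    (2 * (16 * n * Nat.log 2 n) + 1) ^ n < 2 ^ (16 * n * Nat.log 2 n) := by
  set L := Nat.log 2 n with hL
  have hL1 : 1 ≤ L := Nat.log_pos (by norm_num) hn
  have hLn : L ≤ n := Nat.log_le_self 2 n
  have hn2 : n < 2 ^ (L + 1) := Nat.lt_pow_succ_log_self (by norm_num) n
  have hbase : 2 * (16 * n * L) + 1 < 2 ^ (16 * L) := by
    calc 2 * (16 * n * L) + 1 ≤ 64 * (n * n) := by nlinarith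
      _ < 64 * (2 ^ (L + 1) * 2 ^ (L + 1)) := by
        have := Nat.mul_lt_mul'' hn2 hn2
        omega
      _ = 2 ^ (6 + (L + 1) + (L + 1)) := by rw [pow_add, pow_add]; ring
      _ ≤ 2 ^ (16 * L) := Nat.pow_le_pow_right (by norm_num) (by omega)
  calc (2 * (16 * n * L) + 1) ^ n < (2 ^ (16 * L)) ^ n := Nat.pow_lt_pow_left hbase (by omega)
    _ = 2 ^ (16 * n * L) := by rw [← pow_mul]; congr 1; ring

/-- Theorem 1.3, combinatorial form: there is a universal constant `C > 0`
such that for every `n ≥ 2` and every `x = (a₁,…,aₙ) ∈ ℝ^n` there is `S ⊆ H = {0,1}^n ∖ {0}`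
with `|S| ≤ C·n²·log₂ n` such that `S` infers every `h ∈ H` at `x`; in particular the label
and comparison queries on `S` determine whether some nonempty subset of `{a₁,…,aₙ}` sums
to `0`. -/
theorem subsetSum_combinatorial :
    ∃ C : ℝ, 0 < C ∧ ∀ n : ℕ, 2 ≤ n →
      ∀ x : Fin n → ℝ,
        ∃ S ⊆ subsetSumH n,
          ((S.card : ℝ) ≤ C * n ^ 2 * Real.logb 2 n) ∧
          (∀ h ∈ subsetSumH n, Infers S x h) ∧
          (∀ x' : Fin n → ℝ,
            (∀ v ∈ S, SignType.sign (ip x' v) = SignType.sign (ip x v)) →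
            (∀ v ∈ S, ∀ w ∈ S,
              SignType.sign (ip x' (v - w)) = SignType.sign (ip x (v - w))) →
            ((∃ h ∈ subsetSumH n, ip x h = 0) ↔ (∃ h ∈ subsetSumH n, ip x' h = 0))) := by
  refine ⟨102, by norm_num, fun n hn x => ?_⟩
  have h01 : ∀ h ∈ subsetSumH n, ∀ j, h j = 0 ∨ h j = 1 := fun h hh j => by
    simpa using Fintype.mem_piFinset.1 (Finset.mem_filter.1 hh).1 j
  obtain ⟨S, hSH, hSc, hS⟩ := exists_infers_all
    (infProp_of_zero_one (pow_lt_two_pow_of_log hn) h01) (by omega) x n _ subset_rfl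
    (card_subsetSumH_lt n)
  refine ⟨S, hSH, ?_, hS, fun x' h1 h2 => ?_⟩
  · have hL1 : 1 ≤ Nat.log 2 n := Nat.log_pos (by norm_num) hn
    have hnat : S.card ≤ 102 * n ^ 2 * Nat.log 2 n := by
      have : 1 ≤ n * Nat.log 2 n := Nat.mul_pos (by omega) hL1
      nlinarith
    calc (S.card : ℝ) ≤ 102 * n ^ 2 * Nat.log 2 n := by exact_mod_cast hnat
      _ ≤ 102 * n ^ 2 * Real.logb 2 n := by
        gcongr
        exact_mod_cast Real.natLog_le_logb n 2
  · refine exists_congr fun h => and_congr_right fun hh => ?_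
    rw [← sign_eq_zero_iff, ← hS h hh x' h1 h2, sign_eq_zero_iff]

end LDT
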